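/- arXiv:2203.02970 — 2 statements merged into one kernel-verified Lean document; each statement's English description precedes it below -/
import Mathlib

section
/- Let f : ℂ → ℂ be holomorphic, let S be a compact f-invariant set, and suppose there are constants C_u > 0 and λ_u > 1 such that |D(fⁿ)(x)| ≥ C_u⁻¹·λ_uⁿ for all x ∈ S and n ≥ 1. Then for every forward orbit (x_i)_{i≥0} with x₀ ∈ S and every bounded sequence (η_i)_{i≥0} in ℂ, the recurrence ξ_{i+1} − f'(x_i)·ξ_i = η_i (i ≥ 0) has a unique bounded solution (ξ_i)_{i≥0}, and it satisfies sup_i |ξ_i| ≤ (C_u/(λ_u − 1))·sup_i |η_i|. -/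
noncomputable section
open Set Metric Topology Filter ENNReal

/-- A set `S` is invariant under `f` if `f⁻¹(S) = S`. -/
def Invariant {α : Type*} (f : α → α) (S : Set α) : Prop := f ⁻¹' S = S

/-- A set `S` is uniformly expanding for `f : ℂ → ℂ`:
`∃ C > 0, λ > 1` with `|D(fⁿ)(z)| ≥ C·λⁿ` for all `z ∈ S`, `n ≥ 1`. -/
def IsExpandingOn (f : ℂ → ℂ) (S : Set ℂ) : Prop :=
  ∃ C > 0, ∃ lam > 1, ∀ z ∈ S, ∀ n : ℕ, 1 ≤ n → C * lam ^ n ≤ ‖deriv (f^[n]) z‖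

/-- The derivative of an iterate is the product of the derivatives along the orbit. -/
theorem deriv_iterate_eq_prod {𝕜 : Type*} [NontriviallyNormedField 𝕜] {f : 𝕜 → 𝕜}
    (hf : Differentiable 𝕜 f) (n : ℕ) (x : 𝕜) :
    deriv (f^[n]) x = ∏ k ∈ Finset.range n, deriv f (f^[k] x) := by
  induction n with
  | zero => simp
  | succ n ih =>
    rw [Function.iterate_succ', deriv_comp x (hf _) (hf.iterate n x), ih,
      Finset.prod_range_succ, mul_comm]

section ExpandingRecurrence

variable {𝕜 : Type*} [NormedField 𝕜] {a : ℕ → 𝕜} {C lam : ℝ}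

/-- A bounded solution of the homogeneous recurrence `d (i + 1) = a i * d i` with uniformly
expanding coefficients vanishes. -/
theorem eq_zero_of_bounded_of_expanding (hC : 0 < C) (hlam : 1 < lam)
    (ha : ∀ i n, 1 ≤ n → C⁻¹ * lam ^ n ≤ ‖∏ k ∈ Finset.range n, a (i + k)‖)
    {d : ℕ → 𝕜} {R : ℝ} (hR : ∀ i, ‖d i‖ ≤ R) (hd : ∀ i, d (i + 1) = a i * d i) (i : ℕ) :
    d i = 0 := by
  have iterated (n : ℕ) : d (i + n) = (∏ k ∈ Finset.range n, a (i + k)) * d i := by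
    induction n with
    | zero => simp
    | succ n ih => rw [← add_assoc, hd, ih, Finset.prod_range_succ]; ring
  by_contra hne
  have hpos : 0 < ‖d i‖ := norm_pos_iff.mpr hne
  obtain ⟨n, hn⟩ := pow_unbounded_of_one_lt (R * C / ‖d i‖) hlam
  have hgrow : C⁻¹ * lam ^ (n + 1) * ‖d i‖ ≤ R := by
    refine le_trans ?_ (hR (i + (n + 1)))
    rw [iterated, norm_mul]
    gcongr
    exact ha i (n + 1) n.succ_pos
  have hpow : lam ^ n ≤ lam ^ (n + 1) := pow_le_pow_right₀ hlam.le n.le_succ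
  have hle : lam ^ (n + 1) * ‖d i‖ ≤ R * C := by
    rw [mul_assoc, inv_mul_le_iff₀ hC] at hgrow
    linarith
  rw [div_lt_iff₀ hpos] at hn
  nlinarith

/-- The terms of the backward series solving an expanding recurrence are dominated by a
geometric series. -/
theorem norm_div_prod_le_of_expanding (hC : 0 < C) (hlam : 1 < lam)
    (ha : ∀ i n, 1 ≤ n → C⁻¹ * lam ^ n ≤ ‖∏ k ∈ Finset.range n, a (i + k)‖)
    {η : ℕ → 𝕜} {B : ℝ} (hB : ∀ i, ‖η i‖ ≤ B) (i n : ℕ) :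
    ‖η (i + n) / ∏ k ∈ Finset.range (n + 1), a (i + k)‖ ≤ C * B / lam * lam⁻¹ ^ n := by
  have hlam0 : 0 < lam := one_pos.trans hlam
  calc ‖η (i + n) / ∏ k ∈ Finset.range (n + 1), a (i + k)‖
      ≤ B / (C⁻¹ * lam ^ (n + 1)) := by
        rw [norm_div]
        exact div_le_div₀ ((norm_nonneg _).trans (hB 0)) (hB _) (by positivity)
          (ha i (n + 1) n.succ_pos)
    _ = C * B / lam * lam⁻¹ ^ n := by
        rw [inv_pow, pow_succ]
        field_simp

/-- The sum of the geometric series dominating the backward series. -/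
theorem hasSum_geometric_bound {C lam : ℝ} (hlam : 1 < lam) (B : ℝ) :
    HasSum (fun n : ℕ => C * B / lam * lam⁻¹ ^ n) (C / (lam - 1) * B) := by
  have hlam0 : 0 < lam := one_pos.trans hlam
  have hsub : lam - 1 ≠ 0 := (sub_pos.mpr hlam).ne'
  have hinv : (1 - lam⁻¹)⁻¹ = lam / (lam - 1) := by
    rw [← inv_div, sub_div, div_self hlam0.ne', one_div]
  have hval : C / (lam - 1) * B = C * B / lam * (1 - lam⁻¹)⁻¹ := by
    rw [hinv]
    field_simp
  rw [hval]
  exact (hasSum_geometric_of_lt_one (inv_nonneg.mpr hlam0.le)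
    (inv_lt_one_of_one_lt₀ hlam)).mul_left (C * B / lam)

/-- A linear recurrence with uniformly expanding coefficients and bounded inhomogeneity has a
bounded solution, with an explicit bound. -/
theorem exists_bounded_solution_of_expanding [CompleteSpace 𝕜] (hC : 0 < C) (hlam : 1 < lam)
    (ha : ∀ i n, 1 ≤ n → C⁻¹ * lam ^ n ≤ ‖∏ k ∈ Finset.range n, a (i + k)‖)
    {η : ℕ → 𝕜} (hη : ∃ R : ℝ, ∀ i, ‖η i‖ ≤ R) :
    ∃ ξ : ℕ → 𝕜, (∀ i, ξ (i + 1) - a i * ξ i = η i) ∧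
      ∀ B : ℝ, (∀ i, ‖η i‖ ≤ B) → ∀ i, ‖ξ i‖ ≤ C / (lam - 1) * B := by
  obtain ⟨R, hR⟩ := hη
  have hsum (i : ℕ) :
      Summable fun n => η (i + n) / ∏ k ∈ Finset.range (n + 1), a (i + k) :=
    (hasSum_geometric_bound hlam R).summable.of_norm_bounded
      (norm_div_prod_le_of_expanding hC hlam ha hR i)
  have ha0 (i : ℕ) : a i ≠ 0 := by
    have h := ha i 1 le_rfl
    rw [Finset.prod_range_one, add_zero] at h
    exact norm_pos_iff.mp (h.trans_lt' (by positivity))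
  refine ⟨fun i => -∑' n, η (i + n) / ∏ k ∈ Finset.range (n + 1), a (i + k),
    fun i => ?_, fun B hB i => ?_⟩
  · have shifted (n : ℕ) : η (i + (n + 1)) / ∏ k ∈ Finset.range (n + 1 + 1), a (i + k) =
        (a i)⁻¹ * (η (i + 1 + n) / ∏ k ∈ Finset.range (n + 1), a (i + 1 + k)) := by
      rw [Finset.prod_range_succ', add_zero, mul_comm _ (a i), ← div_div,
        div_right_comm, div_eq_inv_mul _ (a i)]
      simp only [add_assoc, add_comm 1]
    simp only [(hsum i).tsum_eq_zero_add, shifted, tsum_mul_left, zero_add,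
      Finset.prod_range_one, add_zero]
    field_simp [ha0 i]
    ring
  · rw [norm_neg]
    exact tsum_of_norm_bounded (hasSum_geometric_bound hlam B)
      (norm_div_prod_le_of_expanding hC hlam ha hB i)

end ExpandingRecurrence

/-- If `|D(fⁿ)(x)| ≥ C_u⁻¹·λ_uⁿ` on a compact invariant set `S` (`C_u > 0`,
`λ_u > 1`), then along every forward orbit from `S` the recurrence
`ξ_{i+1} − f'(x_i)·ξ_i = η_i` has, for every bounded `η`, a unique bounded
solution `ξ`, and `sup_i |ξ_i| ≤ (C_u/(λ_u − 1))·sup_i |η_i|`. -/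
theorem unique_bounded_solution_of_expanding (f : ℂ → ℂ) (hf : Differentiable ℂ f)
    (S : Set ℂ) (hS : IsCompact S) (hinvS : Invariant f S)
    (Cu lamu : ℝ) (hCu : 0 < Cu) (hlamu : 1 < lamu)
    (hexp : ∀ x ∈ S, ∀ n : ℕ, 1 ≤ n → Cu⁻¹ * lamu ^ n ≤ ‖deriv (f^[n]) x‖) :
    ∀ x0 ∈ S, ∀ η : ℕ → ℂ, (∃ R : ℝ, ∀ i, ‖η i‖ ≤ R) →
      ∃ ξ : ℕ → ℂ,
        ((∃ R : ℝ, ∀ i, ‖ξ i‖ ≤ R) ∧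
          ∀ i : ℕ, ξ (i + 1) - deriv f (f^[i] x0) * ξ i = η i) ∧
        (∀ ξ' : ℕ → ℂ,
          ((∃ R : ℝ, ∀ i, ‖ξ' i‖ ≤ R) ∧
            ∀ i : ℕ, ξ' (i + 1) - deriv f (f^[i] x0) * ξ' i = η i) →
          ξ' = ξ) ∧
        ∀ B : ℝ, (∀ i, ‖η i‖ ≤ B) → ∀ i, ‖ξ i‖ ≤ Cu / (lamu - 1) * B := by
  intro x0 hx0 η hη
  have horbit (i : ℕ) : f^[i] x0 ∈ S :=
    MapsTo.iterate (fun x hx => by rwa [← hinvS] at hx) i hx0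
  have ha (i n : ℕ) (hn : 1 ≤ n) :
      Cu⁻¹ * lamu ^ n ≤ ‖∏ k ∈ Finset.range n, deriv f (f^[i + k] x0)‖ := by
    have h := hexp _ (horbit i) n hn
    simpa only [deriv_iterate_eq_prod hf, ← Function.iterate_add_apply, add_comm] using h
  obtain ⟨ξ, hrec, hbound⟩ := exists_bounded_solution_of_expanding
    (a := fun i => deriv f (f^[i] x0)) hCu hlamu ha hη
  obtain ⟨R, hR⟩ := hη
  refine ⟨ξ, ⟨⟨_, hbound R hR⟩, hrec⟩, ?_, hbound⟩
  rintro ξ' ⟨⟨R', hR'⟩, hrec'⟩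
  funext i
  refine sub_eq_zero.mp (eq_zero_of_bounded_of_expanding
    (a := fun i => deriv f (f^[i] x0)) hCu hlamu ha (d := fun i => ξ' i - ξ i) (R := R' + Cu / (lamu - 1) * R) (fun i => ?_) (fun i => ?_) i)
  · exact (norm_sub_le _ _).trans (add_le_add (hR' i) (hbound R hR i))
  · linear_combination hrec' i - hrec i
end
end

section
/- Let f : ℂ → ℂ be holomorphic and let S be a compact f-invariant set. Then S is uniformly expanding if and only if for every forward orbit (x_i)_{i≥0} with x₀ ∈ S and x_i = f^i(x₀), the homogeneous recurrence ξ_{i+1} − f'(x_i)·ξ_i = 0 for all i ≥ 0 has no nonzero bounded solution (ξ_i)_{i≥0}. -/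
noncomputable section
open Set Metric Topology Filter ENNReal

theorem Invariant.iterate_mem {α : Type*} {f : α → α} {S : Set α} (h : Invariant f S) {x : α}
    (hx : x ∈ S) (n : ℕ) : f^[n] x ∈ S :=
  (show MapsTo f S S from Eq.superset h).iterate n hx

theorem deriv_iterate_add {f : ℂ → ℂ} (hf : Differentiable ℂ f) (m n : ℕ) (z : ℂ) :
    deriv f^[m + n] z = deriv f^[m] (f^[n] z) * deriv f^[n] z := by
  rw [Function.iterate_add]
  exact deriv_comp z (hf.iterate m _) (hf.iterate n _)

theorem deriv_iterate_succ {f : ℂ → ℂ} (hf : Differentiable ℂ f) (n : ℕ) (z : ℂ) :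
    deriv f^[n + 1] z = deriv f (f^[n] z) * deriv f^[n] z := by
  rw [add_comm, deriv_iterate_add hf, Function.iterate_one]

theorem deriv_iterate_zero (f : ℂ → ℂ) (z : ℂ) : deriv f^[0] z = 1 := by
  simp

theorem continuous_deriv_iterate {f : ℂ → ℂ} (hf : Differentiable ℂ f) (n : ℕ) :
    Continuous (deriv f^[n]) :=
  ((hf.iterate n).contDiff (n := 1)).continuous_deriv le_rfl

/-- A solution of the homogeneous recurrence along an orbit is a multiple of the derivatives of
the iterates. -/
theorem eq_deriv_iterate_mul {f : ℂ → ℂ} (hf : Differentiable ℂ f) {z : ℂ}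
    {ξ : ℕ → ℂ} (hξ : ∀ i, ξ (i + 1) = deriv f (f^[i] z) * ξ i) (n : ℕ) :
    ξ n = deriv f^[n] z * ξ 0 := by
  induction n with
  | zero => rw [deriv_iterate_zero, one_mul]
  | succ n ih => rw [hξ, ih, deriv_iterate_succ hf, mul_assoc]

theorem IsExpandingOn.eq_zero_of_bounded {f : ℂ → ℂ} (hf : Differentiable ℂ f) {S : Set ℂ}
    (h : IsExpandingOn f S) {z : ℂ} (hz : z ∈ S) {ξ : ℕ → ℂ} {R : ℝ} (hR : ∀ i, ‖ξ i‖ ≤ R)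
    (hξ : ∀ i, ξ (i + 1) = deriv f (f^[i] z) * ξ i) : ξ = 0 := by
  obtain ⟨C, hC, lam, hlam, h⟩ := h
  have h0 : ξ 0 = 0 := by
    by_contra h0
    have h0' : 0 < ‖ξ 0‖ := norm_pos_iff.2 h0
    obtain ⟨n, hn⟩ := pow_unbounded_of_one_lt (R / (C * ‖ξ 0‖)) hlam
    rw [div_lt_iff₀ (by positivity)] at hn
    have hle := h z hz (n + 1) (by lia)
    have hb := hR (n + 1)
    rw [eq_deriv_iterate_mul hf hξ, norm_mul] at hb
    have hmono : lam ^ n ≤ lam ^ (n + 1) := pow_le_pow_right₀ hlam.le n.le_succ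
    have : C * lam ^ n * ‖ξ 0‖ ≤ ‖deriv f^[n + 1] z‖ * ‖ξ 0‖ := by
      refine mul_le_mul_of_nonneg_right (le_trans ?_ hle) h0'.le
      exact mul_le_mul_of_nonneg_left hmono hC.le
    linarith
  funext n
  rw [eq_deriv_iterate_mul hf hξ, h0, mul_zero, Pi.zero_apply]

theorem IsCompact.exists_bound_iterate_expanding {f : ℂ → ℂ} (hf : Differentiable ℂ f) {S : Set ℂ}
    (hS : IsCompact S) {a : ℝ} (h : ∀ z ∈ S, ∃ n, a < ‖deriv f^[n] z‖) :
    ∃ N, ∀ z ∈ S, ∃ n ≤ N, a < ‖deriv f^[n] z‖ := by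
  obtain ⟨N, hN⟩ := hS.elim_directed_cover (fun N : ℕ ↦ ⋃ n ≤ N, {z | a < ‖deriv f^[n] z‖})
    (fun N ↦ isOpen_biUnion fun n _ ↦
      isOpen_lt continuous_const (continuous_deriv_iterate hf n).norm)
    (fun z hz ↦ by
      obtain ⟨n, hn⟩ := h z hz
      exact mem_iUnion.2 ⟨n, mem_biUnion (le_refl n) hn⟩)
    (directed_of_isDirected_le fun M N hMN ↦
      biUnion_subset_biUnion_left fun n (hn : n ≤ M) ↦ hn.trans hMN)
  refine ⟨N, fun z hz ↦ ?_⟩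
  simpa using hN hz

theorem pow_le_norm_deriv_iterate {f : ℂ → ℂ} (hf : Differentiable ℂ f) {S : Set ℂ}
    (hinv : Invariant f S) {m : ℝ} (hm : 0 ≤ m) (h : ∀ z ∈ S, m ≤ ‖deriv f z‖) {z : ℂ}
    (hz : z ∈ S) (n : ℕ) : m ^ n ≤ ‖deriv f^[n] z‖ := by
  induction n with
  | zero => simp
  | succ n ih =>
    rw [deriv_iterate_succ hf, norm_mul, pow_succ']
    exact mul_le_mul (h _ (hinv.iterate_mem hz n)) ih (by positivity) (norm_nonneg _)

/-- If every point of a compact invariant set has some iterate whose derivative there has modulus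
greater than `2`, then the set is uniformly expanding. -/
theorem IsExpandingOn.of_forall_exists {f : ℂ → ℂ} (hf : Differentiable ℂ f) {S : Set ℂ}
    (hS : IsCompact S) (hinv : Invariant f S) (h : ∀ z ∈ S, ∃ n, 2 < ‖deriv f^[n] z‖) :
    IsExpandingOn f S := by
  obtain ⟨N, hN⟩ := hS.exists_bound_iterate_expanding hf h
  have hpos : ∀ z n, 2 < ‖deriv f^[n] z‖ → n ≠ 0 := by
    rintro z n hn rfl
    rw [deriv_iterate_zero, norm_one] at hn
    norm_num at hn
  have hderiv : ∀ z ∈ S, 0 < ‖deriv f z‖ := by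
    intro z hz
    obtain ⟨n, hn⟩ := h z hz
    obtain ⟨k, rfl⟩ := Nat.exists_eq_succ_of_ne_zero (hpos z n hn)
    rw [norm_pos_iff]
    intro h0
    rw [Nat.succ_eq_add_one, deriv_iterate_add hf, Function.iterate_one, h0, mul_zero,
      norm_zero] at hn
    norm_num at hn
  obtain ⟨m', hm', hle'⟩ := hS.exists_forall_le'
    (continuous_deriv_iterate hf 1).norm.continuousOn hderiv
  set m := min m' 1
  have hm : 0 < m := lt_min hm' one_pos
  have hm1 : m ≤ 1 := min_le_right _ _
  have hle : ∀ z ∈ S, m ≤ ‖deriv f z‖ := fun z hz ↦ (min_le_left _ _).trans (hle' z hz)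
  obtain ⟨lam, hlam, hlamN⟩ : ∃ lam : ℝ, 1 < lam ∧ lam ^ (N + 1) = 2 :=
    ⟨2 ^ ((N + 1 : ℕ) : ℝ)⁻¹, Real.one_lt_rpow one_lt_two (by positivity),
      Real.rpow_inv_natCast_pow zero_le_two N.succ_ne_zero⟩
  have hlam2 : ∀ n ≤ N, lam ^ n ≤ 2 := fun n hn ↦
    hlamN ▸ pow_le_pow_right₀ hlam.le (hn.trans N.le_succ)
  refine ⟨m ^ N / 2, by positivity, lam, hlam, fun z hz n _ ↦ ?_⟩
  induction n using Nat.strong_induction_on generalizing z with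
  | _ n ih =>
    obtain ⟨k, hkN, hk⟩ := hN z hz
    have hk0 := hpos z k hk
    rcases lt_or_ge k n with hkn | hnk
    · have hrec := ih (n - k) (by lia) (f^[k] z) (hinv.iterate_mem hz k) (by lia)
      obtain ⟨j, rfl⟩ := Nat.exists_eq_add_of_le' hkn.le
      rw [Nat.add_sub_cancel] at hrec
      rw [deriv_iterate_add hf, norm_mul, pow_add, ← mul_assoc]
      exact mul_le_mul hrec ((hlam2 k hkN).trans hk.le) (by positivity) (norm_nonneg _)
    · calc m ^ N / 2 * lam ^ n ≤ m ^ N / 2 * 2 := by gcongr; exact hlam2 n (hnk.trans hkN)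
        _ = m ^ N := by ring
        _ ≤ m ^ n := pow_le_pow_of_le_one hm.le hm1 (hnk.trans hkN)
        _ ≤ _ := pow_le_norm_deriv_iterate hf hinv hm.le hle hz n

/-- A compact invariant set `S` of a holomorphic map `f : ℂ → ℂ` is uniformly
expanding iff along every forward orbit from `S` the homogeneous recurrence
`ξ_{i+1} = f'(x_i)·ξ_i` (`i ≥ 0`) has no nonzero bounded solution. -/
theorem expanding_iff_no_bounded_homogeneous_solution (f : ℂ → ℂ)
    (hf : Differentiable ℂ f) (S : Set ℂ) (hS : IsCompact S) (hinvS : Invariant f S) :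
    IsExpandingOn f S ↔
      ∀ x0 ∈ S, ∀ ξ : ℕ → ℂ, (∃ R : ℝ, ∀ i, ‖ξ i‖ ≤ R) →
        (∀ i : ℕ, ξ (i + 1) = deriv f (f^[i] x0) * ξ i) → ξ = 0 := by
  refine ⟨fun h x0 hx0 ξ ⟨_, hR⟩ hξ ↦ h.eq_zero_of_bounded hf hx0 hR hξ, fun h ↦
    IsExpandingOn.of_forall_exists hf hS hinvS fun z hz ↦ ?_⟩
  by_contra! hb
  have h0 := congrFun (h z hz (fun n ↦ deriv f^[n] z) ⟨2, hb⟩ fun n ↦ deriv_iterate_succ hf n z) 0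
  exact one_ne_zero ((deriv_iterate_zero f z).symm.trans h0)
end
end
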